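/- Let P : Fin n → ℝ² be a configuration of n labeled points (injective, in general position), and let a, b be distinct indices such that every other point lies strictly to the left of the directed line through P a and P b, i.e., χ_P(a,b,k) = +1 for all k ∉ {a,b}. Let x, y, z be pairwise distinct indices different from a such that χ_P(a,x,y) = +1 and χ_P(a,y,z) = +1 (that is, y lies strictly between x and z in the angular order around P a). Then χ_P(x,y,z) = −1 (the triple (P x, P y, P z) is oriented clockwise) if and only if P y lies in the interior of the triangle with vertices P a, P x, P z. -/

import Mathlib

noncomputable def det2 (v w : ℝ × ℝ) : ℝ := v.1 * w.2 - v.2 * w.1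

noncomputable def chi {α : Type*} (P : α → ℝ × ℝ) (i j k : α) : ℝ :=
  Real.sign (det2 (P j - P i) (P k - P i))

def GenPos {α : Type*} (P : α → ℝ × ℝ) : Prop :=
  ∀ i j k : α, i ≠ j → i ≠ k → j ≠ k → chi P i j k ≠ 0

def Ccw {α : Type*} (P : α → ℝ × ℝ) (i j k l : α) : Prop :=
  (chi P i j k = 1 ∧ chi P i k l = 1) ∨
  (chi P i k l = 1 ∧ chi P i l j = 1) ∨
  (chi P i l j = 1 ∧ chi P i j k = 1)

def Admissible {α : Type*} (i j k l : α) : Prop :=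
  i ≠ j ∧ i ≠ k ∧ i ≠ l ∧ j ≠ k ∧ j ≠ l ∧ k ≠ l

def SameRadial {α : Type*} (P Q : α → ℝ × ℝ) : Prop :=
  ∀ i j k l : α, Admissible i j k l → (Ccw P i j k l ↔ Ccw Q i j k l)

def SameUndirected {α : Type*} (P Q : α → ℝ × ℝ) : Prop :=
  ∀ i : α, (∀ j k l : α, Admissible i j k l → (Ccw Q i j k l ↔ Ccw P i j k l)) ∨
           (∀ j k l : α, Admissible i j k l → (Ccw Q i j k l ↔ Ccw P i l k j))

def ExtremeSet {α : Type*} (P : α → ℝ × ℝ) : Set α :=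
  {i | P i ∉ convexHull ℝ (P '' {j | j ≠ i})}

def Important {n : ℕ} (P₀ : Fin n → ℝ × ℝ) (H : Set (Fin n)) : Prop :=
  ∃ Q : Fin n → ℝ × ℝ, Function.Injective Q ∧ GenPos Q ∧ SameRadial P₀ Q ∧ ExtremeSet Q = H

def lineThrough (p q : ℝ × ℝ) : Set (ℝ × ℝ) := {x | ∃ t : ℝ, x = p + t • (q - p)}

theorem chi_eq_one_iff {α : Type*} (P : α → ℝ × ℝ) (i j k : α) :
    chi P i j k = 1 ↔ 0 < det2 (P j - P i) (P k - P i) := by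
  unfold chi
  rcases lt_trichotomy (det2 (P j - P i) (P k - P i)) 0 with h | h | h
  · simp only [Real.sign_of_neg h, h.not_gt, iff_false]; norm_num
  · simp [h]
  · simp [Real.sign_of_pos h, h]

theorem chi_eq_neg_one_iff {α : Type*} (P : α → ℝ × ℝ) (i j k : α) :
    chi P i j k = -1 ↔ det2 (P j - P i) (P k - P i) < 0 := by
  unfold chi
  rcases lt_trichotomy (det2 (P j - P i) (P k - P i)) 0 with h | h | h
  · simp [Real.sign_of_neg h, h]
  · simp [h]
  · simp only [Real.sign_of_pos h, h.not_gt, iff_false]; norm_num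

/-- The angular order is transitive on vectors in the half-plane to the left of `u`. -/
theorem det2_pos_trans {u v w t : ℝ × ℝ} (huv : 0 ≤ det2 u v) (huw : 0 < det2 u w)
    (hut : 0 < det2 u t) (hvw : 0 < det2 v w) (hwt : 0 < det2 w t) : 0 < det2 v t := by
  have h : det2 u w * det2 v t = det2 u v * det2 w t + det2 u t * det2 v w := by
    unfold det2; ring
  refine pos_of_mul_pos_right (a := det2 u w) ?_ huw.le
  rw [h]
  positivity

/-- A point strictly on the inner side of all three edges of a positively oriented triangle
lies in the interior of the triangle. -/
theorem mem_interior_convexHull_triangle {p q r s : ℝ × ℝ} (hqr : 0 < det2 (q - p) (r - p))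
    (hqs : 0 < det2 (q - p) (s - p)) (hsr : 0 < det2 (s - p) (r - p))
    (h : det2 (s - q) (r - q) < 0) :
    s ∈ interior (convexHull ℝ ({p, q, r} : Set (ℝ × ℝ))) := by
  let U : Set (ℝ × ℝ) := {t | 0 < det2 (q - p) (t - p)} ∩ {t | 0 < det2 (t - p) (r - p)} ∩
    {t | det2 (t - q) (r - q) < 0}
  have hU : IsOpen U := by
    refine ((isOpen_lt ?_ ?_).inter (isOpen_lt ?_ ?_)).inter (isOpen_lt ?_ ?_) <;>
      (try unfold det2) <;> fun_prop
  refine interior_maximal ?_ hU (show s ∈ U from ⟨⟨hqs, hsr⟩, h⟩)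
  rintro t ⟨⟨ht₁, ht₂⟩, ht₃⟩
  simp only [Set.mem_ofPred_eq] at ht₁ ht₂ ht₃
  set D := det2 (q - p) (r - p) with hD
  have hsum := (convex_convexHull ℝ ({p, q, r} : Set (ℝ × ℝ))).sum_mem (t := Finset.univ)
    (w := ![-det2 (t - q) (r - q) / D, det2 (t - p) (r - p) / D, det2 (q - p) (t - p) / D])
    (z := ![p, q, r]) ?_ ?_ ?_
  · convert hsum using 1
    simp only [Fin.sum_univ_three, Matrix.cons_val]
    ext <;> simp only [Prod.fst_add, Prod.snd_add, Prod.smul_fst, Prod.smul_snd, smul_eq_mul] <;>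
      field_simp <;> simp only [hD, det2, Prod.fst_sub, Prod.snd_sub] <;> ring
  · have := neg_pos.2 ht₃
    intro i _
    fin_cases i <;> simp only [Fin.reduceFinMk, Fin.zero_eta, Fin.mk_one, Matrix.cons_val] <;>
      positivity
  · simp only [Fin.sum_univ_three, Matrix.cons_val]
    field_simp
    simp only [hD, det2, Prod.fst_sub, Prod.snd_sub]
    ring
  · intro i _
    apply subset_convexHull
    fin_cases i <;> simp

/-- A triangle lies in the closed half-plane bounded by its edge `qr` that contains `p`. -/
theorem det2_nonpos_of_mem_convexHull_triangle {p q r s : ℝ × ℝ}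
    (hqr : 0 ≤ det2 (q - p) (r - p))
    (hs : s ∈ convexHull ℝ ({p, q, r} : Set (ℝ × ℝ))) : det2 (s - q) (r - q) ≤ 0 := by
  refine convexHull_min (t := {t | det2 (t - q) (r - q) ≤ 0}) ?_ ?_ hs
  · rintro t (rfl | rfl | rfl) <;>
      simp only [Set.mem_ofPred_eq, det2, Prod.fst_sub, Prod.snd_sub] at hqr ⊢ <;> linarith
  · intro t ht u hu α β hα hβ hαβ
    have h : det2 (α • t + β • u - q) (r - q) =
        α * det2 (t - q) (r - q) + β * det2 (u - q) (r - q) := by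
      obtain rfl : β = 1 - α := by linarith
      simp [det2]
      ring
    simp only [Set.mem_ofPred_eq] at ht hu ⊢
    rw [h]
    nlinarith [mul_nonneg hα (neg_nonneg.2 ht), mul_nonneg hβ (neg_nonneg.2 hu)]

/-- with all points to the left of the hull edge `ab`, and `y`
angularly between `x` and `z` around `a`, the triple `(x,y,z)` is clockwise
iff `P y` lies in the interior of the triangle `P a P x P z`. -/
theorem sidedness_from_hull_edge {n : ℕ}
    (P : Fin n → ℝ × ℝ)
    (hinj : Function.Injective P) (hgp : GenPos P)
    (a b : Fin n) (hab : a ≠ b)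
    (hleft : ∀ k : Fin n, k ≠ a → k ≠ b → chi P a b k = 1)
    (x y z : Fin n)
    (hxa : x ≠ a) (hya : y ≠ a) (hza : z ≠ a)
    (hxy : x ≠ y) (hxz : x ≠ z) (hyz : y ≠ z)
    (haxy : chi P a x y = 1) (hayz : chi P a y z = 1) :
    chi P x y z = -1 ↔ P y ∈ interior (convexHull ℝ ({P a, P x, P z} : Set (ℝ × ℝ))) := by
  have hanti (u v : ℝ × ℝ) : det2 v u = -det2 u v := by unfold det2; ring
  have hself (u : ℝ × ℝ) : det2 u u = 0 := by unfold det2; ring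
  simp only [chi_eq_one_iff] at hleft haxy hayz
  have hyb : y ≠ b := by
    rintro rfl
    linarith [hleft x hxa hxy, hanti (P x - P a) (P y - P a)]
  have hzb : z ≠ b := by
    rintro rfl
    linarith [hleft y hya hyz, hanti (P y - P a) (P z - P a)]
  have hbx : 0 ≤ det2 (P b - P a) (P x - P a) := by
    rcases eq_or_ne x b with rfl | hxb
    · exact (hself _).ge
    · exact (hleft x hxa hxb).le
  have haxz : 0 < det2 (P x - P a) (P z - P a) :=
    det2_pos_trans hbx (hleft y hya hyb) (hleft z hza hzb) haxy hayz
  rw [chi_eq_neg_one_iff]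
  refine ⟨mem_interior_convexHull_triangle haxz haxy hayz, fun h ↦ ?_⟩
  refine lt_of_le_of_ne
    (det2_nonpos_of_mem_convexHull_triangle haxz.le (interior_subset h)) fun h₀ ↦ ?_
  exact hgp x y z hxy hxz hyz (by rw [chi, h₀, Real.sign_zero])
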